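/- There exists a constant C such that |G_ε(z)| ≤ C·(‖z‖ + ε)^{−1} uniformly over all ε ∈ (0,1) and all space-time points z with ‖z‖ < 1, where G_ε = K_ε * K_ε. -/

import Mathlib

open MeasureTheory

/-- The parabolic norm on space-time `ℝ×ℝ³` (coordinates `z 0 = t`, `z 1, z 2, z 3 = x`):
`‖z‖ = |t|^{1/2} + |x|`. -/
noncomputable def pnorm (z : Fin 4 → ℝ) : ℝ :=
  Real.sqrt |z 0| + Real.sqrt ((z 1) ^ 2 + (z 2) ^ 2 + (z 3) ^ 2)

/-- The parabolic degree `|ℓ| = 2ℓ₀ + ℓ₁ + ℓ₂ + ℓ₃` of a multi-index. -/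
def pdeg (l : Fin 4 → ℕ) : ℕ := 2 * l 0 + l 1 + l 2 + l 3

/-- Partial derivative in the `i`-th coordinate direction. -/
noncomputable def pd (i : Fin 4) (f : (Fin 4 → ℝ) → ℝ) : (Fin 4 → ℝ) → ℝ :=
  fun z => fderiv ℝ f z (Pi.single i 1)

/-- The multi-index derivative `D^ℓ = ∂_t^{ℓ₀}∂_{x₁}^{ℓ₁}∂_{x₂}^{ℓ₂}∂_{x₃}^{ℓ₃}`. -/
noncomputable def Dmulti (l : Fin 4 → ℕ) (f : (Fin 4 → ℝ) → ℝ) : (Fin 4 → ℝ) → ℝ :=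
  (pd 0)^[l 0] ((pd 1)^[l 1] ((pd 2)^[l 2] ((pd 3)^[l 3] f)))

/-- The parabolic rescaling `φ_ε(t,x) = ε⁻⁵ φ(t/ε², x/ε)`. -/
noncomputable def parRescale (ε : ℝ) (φ : (Fin 4 → ℝ) → ℝ) : (Fin 4 → ℝ) → ℝ :=
  fun z => (ε ^ 5)⁻¹ * φ (fun i => if i = 0 then z 0 / ε ^ 2 else z i / ε)

/-- Space-time convolution `(f*g)(z) = ∫ f(z−w)g(w) dw`. -/
noncomputable def stConv (f g : (Fin 4 → ℝ) → ℝ) : (Fin 4 → ℝ) → ℝ :=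
  fun z => ∫ w : Fin 4 → ℝ, f (z - w) * g w

lemma pnorm_nonneg (z : Fin 4 → ℝ) : 0 ≤ pnorm z := by
  unfold pnorm; positivity

lemma sqrt_abs_zero_le_pnorm (z : Fin 4 → ℝ) : Real.sqrt |z 0| ≤ pnorm z := by
  unfold pnorm
  linarith [Real.sqrt_nonneg ((z 1) ^ 2 + (z 2) ^ 2 + (z 3) ^ 2)]

lemma abs_le_pnorm (z : Fin 4 → ℝ) {i : Fin 4} (hi : i ≠ 0) : |z i| ≤ pnorm z := by
  have h : |z i| ≤ Real.sqrt ((z 1) ^ 2 + (z 2) ^ 2 + (z 3) ^ 2) := by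
    apply Real.abs_le_sqrt
    fin_cases i
    · exact absurd rfl hi
    all_goals
      simp only [Fin.mk_one, Fin.reduceFinMk]
      nlinarith [sq_nonneg (z 1), sq_nonneg (z 2), sq_nonneg (z 3)]
  unfold pnorm
  linarith [Real.sqrt_nonneg |z 0|]

lemma pnorm_pos {z : Fin 4 → ℝ} (h : z 0 ≠ 0) : 0 < pnorm z :=
  (Real.sqrt_pos.2 (abs_pos.2 h)).trans_le (sqrt_abs_zero_le_pnorm z)

lemma sqrt_abs_add_le (a b : ℝ) : Real.sqrt |a + b| ≤ Real.sqrt |a| + Real.sqrt |b| := by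
  rw [Real.sqrt_le_left (by positivity)]
  nlinarith [abs_add_le a b, Real.sq_sqrt (abs_nonneg a), Real.sq_sqrt (abs_nonneg b),
    mul_nonneg (Real.sqrt_nonneg |a|) (Real.sqrt_nonneg |b|)]

lemma sqrt_sum_sq_eq_norm (a b c : ℝ) :
    Real.sqrt (a ^ 2 + b ^ 2 + c ^ 2) = ‖(!₂[a, b, c] : EuclideanSpace ℝ (Fin 3))‖ := by
  simp [EuclideanSpace.norm_eq, Fin.sum_univ_three]

lemma pnorm_add_le (z w : Fin 4 → ℝ) : pnorm (z + w) ≤ pnorm z + pnorm w := by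
  have h := norm_add_le (!₂[z 1, z 2, z 3] : EuclideanSpace ℝ (Fin 3)) !₂[w 1, w 2, w 3]
  have e : (!₂[z 1, z 2, z 3] + !₂[w 1, w 2, w 3] : EuclideanSpace ℝ (Fin 3))
      = !₂[z 1 + w 1, z 2 + w 2, z 3 + w 3] := by
    ext i; fin_cases i <;> simp
  rw [e] at h
  simp only [← sqrt_sum_sq_eq_norm] at h
  have h' := sqrt_abs_add_le (z 0) (w 0)
  simp only [pnorm, Pi.add_apply]
  linarith

lemma pnorm_sub_comm (z w : Fin 4 → ℝ) : pnorm (z - w) = pnorm (w - z) := by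
  simp only [pnorm, Pi.sub_apply]
  rw [abs_sub_comm, sub_sq_comm (z 1), sub_sq_comm (z 2), sub_sq_comm (z 3)]

lemma pnorm_le_add_sub (z w : Fin 4 → ℝ) : pnorm z ≤ pnorm w + pnorm (z - w) := by
  simpa using pnorm_add_le w (z - w)

lemma pnorm_sub_le (z w : Fin 4 → ℝ) : pnorm (z - w) ≤ pnorm z + pnorm w := by
  have h := pnorm_add_le z (0 - w)
  rwa [pnorm_sub_comm 0 w, sub_zero, zero_sub, ← sub_eq_add_neg] at h

lemma continuous_pnorm : Continuous pnorm := by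
  unfold pnorm; fun_prop

/-- The one-dimensional profile `(|s| (M + |s|))^{-3/5}`. -/
noncomputable def profile (M s : ℝ) : ℝ := (|s| * (M + |s|)) ^ (-(3 / 5) : ℝ)

lemma profile_eq_scale {M : ℝ} (hM : 0 < M) (s : ℝ) :
    profile M s = M ^ (-(6 / 5) : ℝ) * profile 1 (M⁻¹ * s) := by
  have e : |s| * (M + |s|) = M ^ (2 : ℝ) * (|M⁻¹ * s| * (1 + |M⁻¹ * s|)) := by
    rw [abs_mul, abs_of_pos (inv_pos.2 hM), Real.rpow_two]
    field_simp
  rw [profile, e, Real.mul_rpow (by positivity) (by positivity), ← Real.rpow_mul hM.le, profile]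
  norm_num

lemma integrable_profile_one : Integrable (profile 1) := by
  have hm : Measurable (profile 1) := by unfold profile; fun_prop
  have h1 : IntegrableOn (profile 1) (Set.Ioc 0 1) := by
    have h : IntegrableOn (fun s : ℝ => s ^ (-(3 / 5) : ℝ)) (Set.Ioc 0 1) :=
      (intervalIntegrable_iff_integrableOn_Ioc_of_le zero_le_one).1
        (intervalIntegral.intervalIntegrable_rpow' (by norm_num))
    refine h.mono' hm.aestronglyMeasurable ?_
    filter_upwards [ae_restrict_mem measurableSet_Ioc] with s hs
    have hs0 : 0 < s := hs.1
    rw [profile, Real.norm_of_nonneg (by positivity), abs_of_pos hs0]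
    exact Real.rpow_le_rpow_of_nonpos hs0 (by nlinarith) (by norm_num)
  have h2 : IntegrableOn (profile 1) (Set.Ioi 1) := by
    have h : IntegrableOn (fun s : ℝ => s ^ (-(6 / 5) : ℝ)) (Set.Ioi 1) :=
      integrableOn_Ioi_rpow_of_lt (by norm_num) one_pos
    refine h.mono' hm.aestronglyMeasurable ?_
    filter_upwards [ae_restrict_mem measurableSet_Ioi] with s hs
    have hs0 : 0 < s := one_pos.trans hs
    have e : s ^ (-(6 / 5) : ℝ) = (s ^ (2 : ℝ)) ^ (-(3 / 5) : ℝ) := by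
      rw [← Real.rpow_mul hs0.le]; norm_num
    rw [profile, Real.norm_of_nonneg (by positivity), abs_of_pos hs0, e, Real.rpow_two]
    exact Real.rpow_le_rpow_of_nonpos (by positivity) (by nlinarith) (by norm_num)
  have h3 : IntegrableOn (profile 1) (Set.Ioi 0) := by
    rw [← Set.Ioc_union_Ioi_eq_Ioi (zero_le_one' ℝ)]
    exact h1.union h2
  have h4 : profile 1 = fun s => profile 1 ‖s‖ := by
    ext s; simp [profile]
  rw [h4, integrable_fun_norm_addHaar]
  simpa using h3

lemma integrable_profile {M : ℝ} (hM : 0 < M) : Integrable (profile M) := by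
  rw [funext (profile_eq_scale hM)]
  exact (integrable_profile_one.comp_mul_left' (inv_ne_zero hM.ne')).const_mul _

lemma integral_profile {M : ℝ} (hM : 0 < M) :
    ∫ s, profile M s = M ^ (-(1 / 5) : ℝ) * ∫ s, profile 1 s := by
  simp_rw [profile_eq_scale hM]
  rw [integral_const_mul, Measure.integral_comp_mul_left, inv_inv, abs_of_pos hM, smul_eq_mul,
    ← mul_assoc, ← Real.rpow_add_one hM.ne']
  norm_num

/-- An integrable product majorant of `‖w‖⁻³ (N + ‖w‖)⁻³`. -/
noncomputable def majorant (N : ℝ) (w : Fin 4 → ℝ) : ℝ :=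
  ∏ i : Fin 4, profile (if i = 0 then N ^ 2 else N) (w i)

lemma integrable_majorant {N : ℝ} (hN : 0 < N) : Integrable (majorant N) := by
  refine Integrable.fintype_prod fun i => integrable_profile ?_
  split_ifs <;> positivity

lemma integral_majorant {N : ℝ} (hN : 0 < N) :
    ∫ w, majorant N w = (∫ s, profile 1 s) ^ 4 * N⁻¹ := by
  unfold majorant
  rw [integral_fintype_prod_volume_eq_prod (fun (i : Fin 4) => profile (if i = 0 then N ^ 2 else N))]
  have e : N⁻¹ = (N ^ 2) ^ (-(1 / 5) : ℝ) * N ^ (-(1 / 5) : ℝ) * N ^ (-(1 / 5) : ℝ)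
      * N ^ (-(1 / 5) : ℝ) := by
    rw [← Real.rpow_two, ← Real.rpow_mul hN.le, ← Real.rpow_add hN, ← Real.rpow_add hN,
      ← Real.rpow_add hN, ← Real.rpow_neg_one]
    norm_num
  rw [Fin.prod_univ_four]
  simp only [if_true, Fin.reduceEq, if_false]
  rw [integral_profile (pow_pos hN 2), integral_profile hN, e]
  ring

lemma le_majorant {N : ℝ} (hN : 0 < N) {w : Fin 4 → ℝ} (hw : ∀ i, w i ≠ 0) :
    ((pnorm w * (N + pnorm w)) ^ 3)⁻¹ ≤ majorant N w := by
  have hq := pnorm_pos (hw 0)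
  set q := pnorm w with hq_def
  have hX : 0 < q * (N + q) := by positivity
  have e : ((q * (N + q)) ^ 3)⁻¹ = ((q * (N + q)) ^ 2) ^ (-(3 / 5) : ℝ)
      * (q * (N + q)) ^ (-(3 / 5) : ℝ) * (q * (N + q)) ^ (-(3 / 5) : ℝ)
      * (q * (N + q)) ^ (-(3 / 5) : ℝ) := by
    rw [← Real.rpow_two, ← Real.rpow_mul hX.le, ← Real.rpow_add hX, ← Real.rpow_add hX,
      ← Real.rpow_add hX, ← Real.rpow_natCast, ← Real.rpow_neg hX.le]
    norm_num
  have h0 : ((q * (N + q)) ^ 2) ^ (-(3 / 5) : ℝ) ≤ profile (N ^ 2) (w 0) := by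
    have hs := abs_pos.2 (hw 0)
    refine Real.rpow_le_rpow_of_nonpos (by positivity) ?_ (by norm_num)
    have h : |w 0| ≤ q ^ 2 := (Real.sqrt_le_left hq.le).1 (sqrt_abs_zero_le_pnorm w)
    calc |w 0| * (N ^ 2 + |w 0|) ≤ q ^ 2 * (N ^ 2 + q ^ 2) := by gcongr
      _ ≤ q ^ 2 * (N + q) ^ 2 := by gcongr; nlinarith
      _ = (q * (N + q)) ^ 2 := by ring
  have h1 : ∀ i : Fin 4, i ≠ 0 → (q * (N + q)) ^ (-(3 / 5) : ℝ) ≤ profile N (w i) := by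
    intro i hi
    have hs := abs_pos.2 (hw i)
    have h := abs_le_pnorm w hi
    exact Real.rpow_le_rpow_of_nonpos (by positivity) (by gcongr) (by norm_num)
  rw [majorant, Fin.prod_univ_four, e]
  simp only [if_true, Fin.reduceEq, if_false]
  have hp : ∀ M s, 0 < M → 0 ≤ profile M s := fun M s hM => by unfold profile; positivity
  gcongr
  · exact mul_nonneg (mul_nonneg (hp _ _ (by positivity)) (hp _ _ hN)) (hp _ _ hN)
  · exact mul_nonneg (hp _ _ (by positivity)) (hp _ _ hN)
  · exact hp _ _ (by positivity)
  · exact h1 1 (by decide)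
  · exact h1 2 (by decide)
  · exact h1 3 (by decide)

/-- A function dominated by `‖w‖⁻³ (N + ‖w‖)⁻³` and its reflection has integral of order `N⁻¹`. -/
lemma abs_integral_le_of_le {N B : ℝ} (hN : 0 < N) (hB : 0 ≤ B) (z : Fin 4 → ℝ)
    {f : (Fin 4 → ℝ) → ℝ}
    (hf : ∀ w, 0 < pnorm w → 0 < pnorm (z - w) → |f w| ≤
      B * (((pnorm w * (N + pnorm w)) ^ 3)⁻¹
        + ((pnorm (z - w) * (N + pnorm (z - w))) ^ 3)⁻¹)) :
    |∫ w, f w| ≤ B * (2 * (∫ s, profile 1 s) ^ 4 * N⁻¹) := by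
  have hi := integrable_majorant hN
  have hi' : Integrable (fun w => majorant N (z - w)) := hi.comp_sub_left z
  have hg : Integrable (fun w => B * (majorant N w + majorant N (z - w))) :=
    (hi.add hi').const_mul B
  have hne : ∀ (c : Fin 4 → ℝ), ∀ᵐ w : Fin 4 → ℝ, ∀ i, w i ≠ c i := by
    intro c
    rw [ae_all_iff]
    intro i
    rw [ae_iff]
    simp only [not_not]
    exact Measure.pi_hyperplane (fun _ : Fin 4 => (volume : Measure ℝ)) i (c i)
  have hle : ∀ᵐ w, ‖f w‖ ≤ B * (majorant N w + majorant N (z - w)) := by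
    filter_upwards [hne 0, hne z] with w h0 hz
    have h1 : ∀ i, (z - w) i ≠ 0 := fun i => sub_ne_zero.2 (hz i).symm
    refine (hf w (pnorm_pos (h0 0)) (pnorm_pos (h1 0))).trans ?_
    have := le_majorant hN h0
    have := le_majorant hN h1
    gcongr
  refine (norm_integral_le_of_norm_le hg hle).trans (le_of_eq ?_)
  rw [integral_const_mul, integral_add hi hi', integral_sub_left_eq_self (majorant N) volume z,
    integral_majorant hN]
  ring

lemma exists_abs_parRescale_le {ρ : (Fin 4 → ℝ) → ℝ} (hρ : Continuous ρ)
    (hρ_supp : HasCompactSupport ρ) :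
    ∃ D : ℝ, 0 ≤ D ∧ ∀ ε : ℝ, 0 < ε → ∀ u,
      |parRescale ε ρ u| ≤ D * ε * ((ε + pnorm u) ^ 6)⁻¹ := by
  have hc : Continuous (fun v => ρ v * (1 + pnorm v) ^ 6) := by
    have := continuous_pnorm
    fun_prop
  obtain ⟨D, hD⟩ := hc.bounded_above_of_compact_support hρ_supp.mul_right
  refine ⟨D, (norm_nonneg _).trans (hD 0), fun ε hε u => ?_⟩
  set v : Fin 4 → ℝ := fun i => if i = 0 then u 0 / ε ^ 2 else u i / ε with hv
  have hpv : pnorm v = pnorm u / ε := by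
    have e : (u 1 / ε) ^ 2 + (u 2 / ε) ^ 2 + (u 3 / ε) ^ 2
        = (u 1 ^ 2 + u 2 ^ 2 + u 3 ^ 2) / ε ^ 2 := by ring
    simp only [pnorm, hv, if_true, Fin.reduceEq, if_false]
    rw [e, abs_div, abs_of_pos (pow_pos hε 2), Real.sqrt_div (abs_nonneg _),
      Real.sqrt_div (by positivity), Real.sqrt_sq hε.le]
    ring
  have hu := pnorm_nonneg u
  have h := hD v
  rw [norm_mul, hpv, Real.norm_eq_abs, Real.norm_of_nonneg (by positivity)] at h
  have e : (1 + pnorm u / ε) ^ 6 = (ε + pnorm u) ^ 6 / ε ^ 6 := by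
    field_simp
  rw [e] at h
  have : |parRescale ε ρ u| = (ε ^ 5)⁻¹ * |ρ v| := by
    rw [parRescale, abs_mul, abs_of_pos (by positivity)]
  rw [this, ← div_eq_mul_inv, le_div_iff₀ (by positivity)]
  calc (ε ^ 5)⁻¹ * |ρ v| * (ε + pnorm u) ^ 6
      = ε * (|ρ v| * ((ε + pnorm u) ^ 6 / ε ^ 6)) := by field_simp
    _ ≤ ε * D := by gcongr
    _ = D * ε := mul_comm _ _

lemma inv_mul_inv_le_of_triangle {n ε a b : ℝ} (hn : 0 ≤ n) (hε : 0 < ε) (ha : 0 < a) (hb : 0 < b)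
    (h1 : n ≤ a + b) (h2 : a ≤ n + b) (h3 : b ≤ n + a) :
    ((b + ε) ^ 3)⁻¹ * ((a + ε) ^ 3)⁻¹ ≤
      125 * (((a * (n + ε + a)) ^ 3)⁻¹ + ((b * (n + ε + b)) ^ 3)⁻¹) := by
  have key : ∀ {a b : ℝ}, 0 < a → 0 < b → a ≤ n + b → n + ε ≤ 2 * (b + ε) →
      ((b + ε) ^ 3)⁻¹ * ((a + ε) ^ 3)⁻¹ ≤ 125 * ((a * (n + ε + a)) ^ 3)⁻¹ := by
    intro a b ha hb h2 h
    have : a * (n + ε + a) ≤ 5 * ((b + ε) * (a + ε)) := by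
      calc a * (n + ε + a) ≤ (a + ε) * (5 * (b + ε)) := by gcongr <;> linarith
        _ = _ := by ring
    rw [← mul_inv, ← div_eq_mul_inv, le_div_iff₀ (by positivity), ← div_eq_inv_mul,
      div_le_iff₀ (by positivity)]
    calc (a * (n + ε + a)) ^ 3 ≤ (5 * ((b + ε) * (a + ε))) ^ 3 := by gcongr
      _ = _ := by ring
  have pa : 0 < ((a * (n + ε + a)) ^ 3)⁻¹ := by positivity
  have pb : 0 < ((b * (n + ε + b)) ^ 3)⁻¹ := by positivity
  rcases le_total (n + ε) (2 * (b + ε)) with h | h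
  · linarith [key ha hb h2 h]
  · have := key hb ha h3 (by linarith)
    rw [mul_comm] at this
    linarith

lemma inv_mul_inv_pow_six_le_of_triangle {n ε a b : ℝ} (hn : 0 ≤ n) (hε : 0 < ε) (ha : 0 < a)
    (hb : 0 < b) (h1 : n ≤ a + b) :
    (b ^ 3)⁻¹ * ((ε + a) ^ 6)⁻¹ ≤
      1000 * ((n + ε) ^ 3)⁻¹ * (((a * (ε + a)) ^ 3)⁻¹ + ((b * (ε + b)) ^ 3)⁻¹) := by
  have pa : 0 < ((n + ε) ^ 3)⁻¹ * ((a * (ε + a)) ^ 3)⁻¹ := by positivity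
  have pb : 0 < ((n + ε) ^ 3)⁻¹ * ((b * (ε + b)) ^ 3)⁻¹ := by positivity
  have of_le : ∀ {c : ℝ}, 0 < c → (n + ε) * c ≤ 10 * (b * (ε + a) ^ 2) →
      (b ^ 3)⁻¹ * ((ε + a) ^ 6)⁻¹ ≤ 1000 * (((n + ε) ^ 3)⁻¹ * (c ^ 3)⁻¹) := by
    intro c hc h
    rw [← mul_inv, ← mul_inv, ← div_eq_mul_inv, le_div_iff₀ (by positivity), ← div_eq_inv_mul,
      div_le_iff₀ (by positivity)]
    calc (n + ε) ^ 3 * c ^ 3 = ((n + ε) * c) ^ 3 := by ring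
      _ ≤ (10 * (b * (ε + a) ^ 2)) ^ 3 := by gcongr
      _ = _ := by ring
  rcases le_total (n + ε) (2 * b) with h | h
  · have := of_le (c := a * (ε + a)) (by positivity) (by
      calc (n + ε) * (a * (ε + a)) ≤ (10 * b) * ((ε + a) * (ε + a)) := by
            gcongr <;> linarith
        _ = _ := by ring)
    linarith
  · have := of_le (c := b * (ε + b)) (by positivity) (by
      calc (n + ε) * (b * (ε + b)) ≤ (2 * (ε + a)) * (b * (5 * (ε + a))) := by
            gcongr <;> linarith
        _ = _ := by ring)
    linarith

lemma exists_abs_stConv_parRescale_le {ρ K : (Fin 4 → ℝ) → ℝ} {C₀ : ℝ}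
    (hρ : Continuous ρ) (hρ_supp : HasCompactSupport ρ)
    (hK : ∀ z : Fin 4 → ℝ, z ≠ 0 → |K z| ≤ C₀ * pnorm z ^ (-(3 : ℝ))) :
    ∃ C : ℝ, 0 ≤ C ∧ ∀ ε : ℝ, 0 < ε → ∀ z,
      |stConv K (parRescale ε ρ) z| ≤ C * ((pnorm z + ε) ^ 3)⁻¹ := by
  obtain ⟨D, hD, hρD⟩ := exists_abs_parRescale_le hρ hρ_supp
  refine ⟨|C₀| * D * 2000 * (∫ s, profile 1 s) ^ 4, by positivity, fun ε hε z => ?_⟩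
  have hz := pnorm_nonneg z
  have h := abs_integral_le_of_le (N := ε)
    (B := |C₀| * D * ε * (1000 * ((pnorm z + ε) ^ 3)⁻¹)) hε (by positivity) z
    (f := fun w => K (z - w) * parRescale ε ρ w) (by
      intro w hw hzw
      have hne : z - w ≠ 0 := by
        rintro h
        rw [h] at hzw
        simp [pnorm] at hzw
      have hKb : |K (z - w)| ≤ |C₀| * (pnorm (z - w) ^ 3)⁻¹ := by
        refine (hK _ hne).trans ?_
        rw [Real.rpow_neg hzw.le, Real.rpow_ofNat]
        gcongr
        exact le_abs_self _
      have ht := inv_mul_inv_pow_six_le_of_triangle hz hε hw hzw (pnorm_le_add_sub z w)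
      rw [abs_mul]
      calc |K (z - w)| * |parRescale ε ρ w|
          ≤ (|C₀| * (pnorm (z - w) ^ 3)⁻¹) * (D * ε * ((ε + pnorm w) ^ 6)⁻¹) := by
            gcongr
            exact hρD ε hε w
        _ = |C₀| * D * ε * ((pnorm (z - w) ^ 3)⁻¹ * ((ε + pnorm w) ^ 6)⁻¹) := by ring
        _ ≤ |C₀| * D * ε * _ := mul_le_mul_of_nonneg_left ht (by positivity)
        _ = _ := (mul_assoc _ _ _).symm)
  refine h.trans (le_of_eq ?_)
  field_simp
  ring

/-- With `K_ε = K*ρ_ε` and `G_ε = K_ε*K_ε`, one has `|G_ε(z)| ≤ C·(‖z‖ + ε)⁻¹`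
uniformly over `ε ∈ (0,1)` and `‖z‖ < 1`. -/
theorem stmt_9 (ρ K : (Fin 4 → ℝ) → ℝ) (C₀ : ℝ)
    (hρ_smooth : ContDiff ℝ (⊤ : ℕ∞) ρ) (hρ_supp : HasCompactSupport ρ)
    (hρ_int : ∫ z, ρ z = 1)
    (hK_smooth : ContDiffOn ℝ (⊤ : ℕ∞) K {(0 : Fin 4 → ℝ)}ᶜ)
    (hK_supp : ∀ z, 1 < pnorm z → K z = 0)
    (hK_bound : ∀ z : Fin 4 → ℝ, z ≠ 0 → |K z| ≤ C₀ * pnorm z ^ (-(3 : ℝ))) :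
    ∃ C : ℝ, ∀ ε : ℝ, 0 < ε → ε < 1 → ∀ z : Fin 4 → ℝ, pnorm z < 1 →
      |stConv (stConv K (parRescale ε ρ)) (stConv K (parRescale ε ρ)) z|
        ≤ C * (pnorm z + ε)⁻¹ := by
  obtain ⟨C, hC, hKε⟩ := exists_abs_stConv_parRescale_le hρ_smooth.continuous hρ_supp hK_bound
  refine ⟨C ^ 2 * 250 * (∫ s, profile 1 s) ^ 4, fun ε hε _ z _ => ?_⟩
  have hz := pnorm_nonneg z
  have h := abs_integral_le_of_le (N := pnorm z + ε) (B := C ^ 2 * 125) (by positivity)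
    (by positivity) z
    (f := fun w => stConv K (parRescale ε ρ) (z - w) * stConv K (parRescale ε ρ) w) (by
      intro w hw hzw
      have hwz := pnorm_le_add_sub w z
      rw [pnorm_sub_comm] at hwz
      have ht := inv_mul_inv_le_of_triangle hz hε hw hzw (pnorm_le_add_sub z w) hwz (pnorm_sub_le z w)
      rw [abs_mul]
      calc |stConv K (parRescale ε ρ) (z - w)| * |stConv K (parRescale ε ρ) w|
          ≤ (C * ((pnorm (z - w) + ε) ^ 3)⁻¹) * (C * ((pnorm w + ε) ^ 3)⁻¹) := by
            gcongr
            · exact hKε ε hε _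
            · exact hKε ε hε _
        _ = C ^ 2 * (((pnorm (z - w) + ε) ^ 3)⁻¹ * ((pnorm w + ε) ^ 3)⁻¹) := by ring
        _ ≤ C ^ 2 * _ := mul_le_mul_of_nonneg_left ht (by positivity)
        _ = _ := (mul_assoc _ _ _).symm)
  refine h.trans (le_of_eq ?_)
  ring
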